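/- Let G ≤ GL_n(F) be a finite reflection group. If ω₁,...,ωₙ are G-invariant 1-forms with ω₁ ∧ ... ∧ ωₙ = c·Q(Ã)·Q_det·vol for some nonzero scalar c ∈ F, then ω₁,...,ωₙ form a basis of (Ω¹)^G as a free module over F[V]^G, i.e., (Ω¹)^G = ⊕ᵢ F[V]^G ωᵢ. -/

import Mathlib

open MvPolynomial

abbrev GLn (F : Type*) [Field F] (n : ℕ) := (Fin n → F) ≃ₗ[F] (Fin n → F)

variable {F : Type*} [Field F] {n : ℕ}

/-- Matrix of the contragredient action of `g` on the coordinate functions: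
`g · z_i = ∑ j (actMat g i j) z_j`. -/
noncomputable def actMat (g : GLn F n) : Matrix (Fin n) (Fin n) F :=
  Matrix.of fun i j => g.symm (Pi.single j 1) i

/-- Action of `g ∈ GL(V)` on polynomials `F[V]` (contragredient action). -/
noncomputable def polyAct (g : GLn F n) : MvPolynomial (Fin n) F →ₐ[F] MvPolynomial (Fin n) F :=
  aeval fun i => ∑ j, C (actMat g i j) * X j

/-- The degree-one polynomial corresponding to a linear form on `V`. -/
noncomputable def linToPoly (z : (Fin n → F) →ₗ[F] F) : MvPolynomial (Fin n) F :=
  ∑ j, C (z (Pi.single j 1)) * X j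

/-- The invariant ring `F[V]^G` as a subalgebra of `F[V]`. -/
noncomputable def invSub (G : Subgroup (GLn F n)) : Subalgebra F (MvPolynomial (Fin n) F) where
  carrier := {f | ∀ g ∈ G, polyAct g f = f}
  add_mem' := fun {a b} ha hb g hg => by rw [map_add, ha g hg, hb g hg]
  mul_mem' := fun {a b} ha hb g hg => by rw [map_mul, ha g hg, hb g hg]
  algebraMap_mem' := fun r g hg => (polyAct g).commutes r

/-- Action of `g` on a differential 1-form `ω = ∑ i (w i) dz_i`; the result is the
coefficient vector of `g · ω`. -/
noncomputable def oneFormAct (g : GLn F n) (w : Fin n → MvPolynomial (Fin n) F) :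
    Fin n → MvPolynomial (Fin n) F :=
  fun j => ∑ i, polyAct g (w i) * C (actMat g i j)

/-- The coefficient of `dz_J` in `g · dz_I` (a minor determinant of `actMat g`). -/
noncomputable def minorDet (g : GLn F n) (I J : Finset (Fin n)) : F :=
  if h : J.card = I.card then
    Matrix.det (Matrix.of fun a b : Fin I.card =>
      actMat g (I.orderIsoOfFin rfl a) (J.orderIsoOfFin h b))
  else 0

/-- Action of `g` on a differential form `μ = ∑_I u_I dz_I`, given by its coefficient
function `u : Finset (Fin n) → F[V]`. -/
noncomputable def formAct (g : GLn F n) (u : Finset (Fin n) → MvPolynomial (Fin n) F) :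
    Finset (Fin n) → MvPolynomial (Fin n) F :=
  fun J => ∑ I : Finset (Fin n), polyAct g (u I) * C (minorDet g I J)

/-- The sign arising when wedging `dz_I ∧ dz_J` into `dz_(I ∪ J)` for disjoint `I`, `J`. -/
def wsign (I J : Finset (Fin n)) : ℤ :=
  (-1) ^ ((I ×ˢ J).filter fun p => p.2 < p.1).card

/-- Wedge product of differential forms in terms of coefficient functions. -/
noncomputable def wedgeF (u v : Finset (Fin n) → MvPolynomial (Fin n) F) :
    Finset (Fin n) → MvPolynomial (Fin n) F :=
  fun K => ∑ I ∈ K.powerset, wsign I (K \ I) • (u I * v (K \ I))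

/-- The constant 0-form `1`. -/
noncomputable def unitForm : Finset (Fin n) → MvPolynomial (Fin n) F :=
  fun S => if S = ∅ then 1 else 0

/-- Iterated wedge product of a list of forms. -/
noncomputable def iterWedge (L : List (Finset (Fin n) → MvPolynomial (Fin n) F)) :
    Finset (Fin n) → MvPolynomial (Fin n) F :=
  L.foldr wedgeF unitForm

/-- A 1-form, viewed as a differential form via its coefficient function. -/
noncomputable def oneToForm (w : Fin n → MvPolynomial (Fin n) F) :
    Finset (Fin n) → MvPolynomial (Fin n) F :=
  fun S => if h : S.card = 1 then w (S.min' (Finset.card_pos.mp (by omega))) else 0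

/-- The fixed space of `g` in `V`. -/
noncomputable def fixedSpace (g : GLn F n) : Submodule F (Fin n → F) :=
  LinearMap.ker (g.toLinearMap - LinearMap.id)

/-- A reflection: an element of finite order whose fixed space is a hyperplane. -/
def IsReflection (g : GLn F n) : Prop :=
  IsOfFinOrder g ∧ Module.finrank F (fixedSpace g) = n - 1

/-- A transvection: a (necessarily nondiagonalizable) reflection of determinant one. -/
def IsTransvection (g : GLn F n) : Prop :=
  IsReflection g ∧ LinearMap.det g.toLinearMap = 1 ∧ g ≠ 1

/-- The pointwise stabilizer `G_H` of a subspace `H` in `G`. -/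
def pointStab (G : Subgroup (GLn F n)) (H : Submodule F (Fin n → F)) : Subgroup (GLn F n) where
  carrier := {g | g ∈ G ∧ ∀ v ∈ H, g v = v}
  one_mem' := ⟨G.one_mem, fun v _ => rfl⟩
  mul_mem' := fun {a b} ha hb => ⟨G.mul_mem ha.1 hb.1, fun v hv => by
    show a (b v) = v
    rw [hb.2 v hv, ha.2 v hv]⟩
  inv_mem' := fun {a} ha => ⟨G.inv_mem ha.1, fun v hv => by
    show a.symm v = v
    conv_lhs => rw [← ha.2 v hv]
    exact a.symm_apply_apply v⟩

/-- `K_H`: the subgroup of `G_H` of elements of determinant one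
(the transvections in `G_H` together with the identity). -/
noncomputable def KH (G : Subgroup (GLn F n)) (H : Submodule F (Fin n → F)) :
    Subgroup (GLn F n) :=
  pointStab G H ⊓ MonoidHom.ker LinearEquiv.det

/-- `e_H = |G_H : K_H|`. -/
noncomputable def eH (G : Subgroup (GLn F n)) (H : Submodule F (Fin n → F)) : ℕ :=
  ((KH G H).subgroupOf (pointStab G H)).index

/-- The transvection root space of `G_H`: the span of the root vectors of the
transvections in `G_H` (the root vector of `t` spans the range of `t - 1`). -/
noncomputable def trvSpace (G : Subgroup (GLn F n)) (H : Submodule F (Fin n → F)) :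
    Submodule F (Fin n → F) :=
  ⨆ g ∈ {g : GLn F n | g ∈ pointStab G H ∧ IsTransvection g},
    LinearMap.range (g.toLinearMap - LinearMap.id)

/-- `b_H`: the dimension of the transvection root space of `G_H`. -/
noncomputable def bH (G : Subgroup (GLn F n)) (H : Submodule F (Fin n → F)) : ℕ :=
  Module.finrank F (trvSpace G H)

/-- The contraction of the 1-form with coefficient vector `w` along the constant vector field
`v`. -/
noncomputable def contract (v : Fin n → F) (w : Fin n → MvPolynomial (Fin n) F) :
    MvPolynomial (Fin n) F :=
  ∑ j, w j * C (v j)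

lemma contract_sub (u v : Fin n → F) (w : Fin n → MvPolynomial (Fin n) F) :
    contract (u - v) w = contract u w - contract v w := by
  simp [contract, mul_sub, Finset.sum_sub_distrib]

lemma contract_add (u v : Fin n → F) (w : Fin n → MvPolynomial (Fin n) F) :
    contract (u + v) w = contract u w + contract v w := by
  simp [contract, mul_add, Finset.sum_add_distrib]

lemma contract_smul (r : F) (v : Fin n → F) (w : Fin n → MvPolynomial (Fin n) F) :
    contract (r • v) w = C r * contract v w := by
  simp only [contract, Pi.smul_apply, smul_eq_mul, C_mul, Finset.mul_sum]
  exact Finset.sum_congr rfl fun j _ => by ring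

lemma sum_actMat_mul (g : GLn F n) (v : Fin n → F) (i : Fin n) :
    ∑ j, actMat g i j * v j = g.symm v i := by
  have h : v = ∑ j, v j • (Pi.single j 1 : Fin n → F) := by
    ext k
    simp [Pi.single_apply]
  conv_rhs => rw [h]
  simp [actMat, mul_comm]

lemma contract_apply_of_invariant {g : GLn F n} {w : Fin n → MvPolynomial (Fin n) F}
    (hw : oneFormAct g w = w) (v : Fin n → F) :
    contract (g v) w = polyAct g (contract v w) := by
  have hC : ∀ r : F, polyAct g (C r) = C r := fun r => (polyAct g).commutes r
  calc contract (g v) w = contract (g v) (oneFormAct g w) := by rw [hw]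
    _ = ∑ i, polyAct g (w i) * ∑ j, C (actMat g i j * g v j) := by
      simp only [contract, oneFormAct, Finset.sum_mul, Finset.mul_sum, C_mul, mul_assoc]
      exact Finset.sum_comm
    _ = ∑ i, polyAct g (w i) * C (v i) := by
      refine Finset.sum_congr rfl fun i _ => ?_
      rw [← map_sum, sum_actMat_mul, LinearEquiv.symm_apply_apply]
    _ = polyAct g (contract v w) := by simp [contract, hC]

lemma eval_linToPoly (z : (Fin n → F) →ₗ[F] F) (v : Fin n → F) :
    eval v (linToPoly z) = z v := by
  have h : v = ∑ j, v j • (Pi.single j 1 : Fin n → F) := by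
    ext k
    simp [Pi.single_apply]
  conv_rhs => rw [h]
  simp [linToPoly, mul_comm]

lemma irreducible_linToPoly {z : (Fin n → F) →ₗ[F] F} (hz : z ≠ 0) :
    Irreducible (linToPoly z) := by
  obtain ⟨i, hi⟩ : ∃ i, z (Pi.single i 1) ≠ 0 := by
    by_contra! h
    exact hz ((Pi.basisFun F (Fin n)).ext fun i => by simpa using h i)
  let c : Fin n →₀ F := Finsupp.equivFunOnFinite.symm fun j => z (Pi.single j 1)
  have hc : linToPoly z = sumSMulX c := by
    rw [sumSMulX, Finsupp.linearCombination_apply, Finsupp.sum_fintype _ _ (by simp)]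
    simp [linToPoly, c, smul_eq_C_mul]
  rw [hc]
  refine irreducible_sumSMulX c ⟨i, by simpa [c] using hi⟩ fun r hr => ?_
  exact isUnit_of_dvd_unit (hr i) (isUnit_iff_ne_zero.mpr (by simpa [c] using hi))

lemma ker_le_of_linToPoly_dvd {y z : (Fin n → F) →ₗ[F] F} (h : linToPoly y ∣ linToPoly z) :
    LinearMap.ker y ≤ LinearMap.ker z := fun v hv => by
  obtain ⟨q, hq⟩ := h
  rw [LinearMap.mem_ker] at hv ⊢
  rw [← eval_linToPoly, hq, map_mul, eval_linToPoly, hv, zero_mul]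

lemma isRelPrime_linToPoly {y z : (Fin n → F) →ₗ[F] F} (hy : y ≠ 0) (hz : z ≠ 0)
    (h : LinearMap.ker y ≠ LinearMap.ker z) : IsRelPrime (linToPoly y) (linToPoly z) := by
  have hy' := irreducible_linToPoly hy
  rw [hy'.isRelPrime_iff_not_dvd]
  exact fun hd => h (le_antisymm (ker_le_of_linToPoly_dvd hd)
    (ker_le_of_linToPoly_dvd (hy'.dvd_symm (irreducible_linToPoly hz) hd)))

section FixingHyperplane

variable {g : GLn F n} {z : (Fin n → F) →ₗ[F] F} {a : Fin n → F}

lemma exists_root_of_fix_ker (hz : z ≠ 0) (hg : ∀ v ∈ LinearMap.ker z, g v = v) :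
    ∃ a, ∀ v, g v = v + z v • a := by
  obtain ⟨u, hu⟩ := LinearMap.surjective hz 1
  refine ⟨g u - u, fun v => ?_⟩
  have h := hg (v - z v • u) (by simp [hu])
  rw [map_sub, map_smul] at h
  rw [smul_sub, ← sub_eq_zero]
  rw [← sub_eq_zero] at h
  rw [← h]
  abel

lemma det_of_root (hg : ∀ v, g v = v + z v • a) : LinearMap.det g.toLinearMap = 1 + z a := by
  have h : g.toLinearMap = LinearMap.transvection z a :=
    LinearMap.ext fun v => by simp [LinearMap.transvection.apply, hg]
  rw [h, LinearMap.transvection.det]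

lemma polyAct_X_of_root (hg : ∀ v, g.symm v = v + z v • a) (i : Fin n) :
    polyAct g (X i) = X i + C (a i) * linToPoly z := by
  simp only [polyAct, aeval_X, actMat, Matrix.of_apply, hg, linToPoly, Finset.mul_sum]
  simp [add_mul, Finset.sum_add_distrib, Pi.single_apply, mul_assoc, mul_left_comm]

lemma dvd_polyAct_sub (hg : ∀ v, g.symm v = v + z v • a) (p : MvPolynomial (Fin n) F) :
    linToPoly z ∣ polyAct g p - p := by
  let q := Ideal.Quotient.mkₐ F (Ideal.span {linToPoly z})
  have h : q.comp (polyAct g) = q := by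
    refine algHom_ext fun i => ?_
    rw [AlgHom.comp_apply, polyAct_X_of_root hg, map_add, add_eq_left]
    exact Ideal.Quotient.eq_zero_iff_mem.mpr
      (Ideal.mem_span_singleton.mpr (Dvd.intro_left _ rfl))
  rw [← Ideal.mem_span_singleton, ← Ideal.Quotient.eq]
  exact DFunLike.congr_fun h p

lemma polyAct_linToPoly_of_root (hg : ∀ v, g.symm v = v + z v • a) :
    polyAct g (linToPoly z) = C (1 + z a) * linToPoly z := by
  have hC : ∀ r : F, polyAct g (C r) = C r := fun r => (polyAct g).commutes r
  have ha : C (z a) = ∑ j, C (z (Pi.single j 1)) * (C (a j) : MvPolynomial (Fin n) F) := by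
    have h := congrArg (C (σ := Fin n)) (eval_linToPoly z a).symm
    rw [h, linToPoly]
    simp only [map_sum, map_mul, eval_C, eval_X]
  conv_lhs => rw [linToPoly]
  simp only [map_sum, map_mul, hC, polyAct_X_of_root hg, mul_add, Finset.sum_add_distrib]
  rw [C_add, C_1, add_mul, one_mul, ha, Finset.sum_mul]
  congr 1
  exact Finset.sum_congr rfl fun j _ => by ring

end FixingHyperplane

/-- If `σ` is congruent to the identity modulo the prime `L`, scales `L` by `κ` and `f` by `η`,
then the multiplicity `k` of `L` in `f` satisfies `κ ^ k = η`. -/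
lemma pow_dvd_of_semiinvariant {R : Type*} [CommRing R] [IsDomain R] [Algebra F R]
    [WfDvdMonoid R] {L f : R} (hL : Prime L) {σ : R →ₐ[F] R} {κ η : F} {m : ℕ}
    (hσ : ∀ p, L ∣ σ p - p) (hσL : σ L = algebraMap F R κ * L) (hf : σ f = algebraMap F R η * f)
    (hm : ∀ k, κ ^ k = η → (L ∣ f → k ≠ 0) → m ≤ k) : L ^ m ∣ f := by
  rcases eq_or_ne f 0 with rfl | hf0
  · exact dvd_zero _
  obtain ⟨k, q, hq, rfl⟩ := WfDvdMonoid.max_power_factor hf0 hL.irreducible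
  refine Dvd.dvd.mul_right (pow_dvd_pow _ (hm k ?_ ?_)) _
  · have h1 : algebraMap F R (κ ^ k) * σ q = algebraMap F R η * q := by
      refine mul_left_cancel₀ (pow_ne_zero k hL.ne_zero) ?_
      rw [map_mul, map_pow, hσL] at hf
      rw [map_pow]
      linear_combination hf
    have h2 : L ∣ algebraMap F R (η - κ ^ k) * q := by
      have h3 : algebraMap F R (η - κ ^ k) * q = algebraMap F R (κ ^ k) * (σ q - q) := by
        rw [map_sub]
        linear_combination -h1
      rw [h3]
      exact (hσ q).mul_left _
    by_contra hne
    have hu : IsUnit (algebraMap F R (η - κ ^ k)) :=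
      (isUnit_iff_ne_zero.mpr (sub_ne_zero.mpr (Ne.symm hne))).map _
    exact hq (hu.dvd_mul_left.mp h2)
  · rintro h rfl
    exact hq (by simpa using h)

lemma exists_basis_sum_of_linearIndependent {V ι : Type*} [AddCommGroup V] [Module F V]
    [Module.Finite F V] {v : ι → V} (hv : LinearIndependent F v) :
    ∃ (m : ℕ) (b : Module.Basis (ι ⊕ Fin m) F V), ∀ k, b (Sum.inl k) = v k := by
  obtain ⟨W, hW⟩ := Submodule.exists_isCompl (Submodule.span F (Set.range v))
  refine ⟨_, ((Module.Basis.span hv).prod (Module.finBasis F W)).map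
    (Submodule.prodEquivOfIsCompl _ W hW), fun k => ?_⟩
  simp [Module.Basis.span_apply]

lemma Submodule.exists_linearIndependent_fin_finrank {V : Type*} [AddCommGroup V] [Module F V]
    [Module.Finite F V] (W : Submodule F V) :
    ∃ t : Fin (Module.finrank F W) → V, LinearIndependent F t ∧ ∀ k, t k ∈ W :=
  ⟨fun k => Module.finBasis F W k,
    (Module.finBasis F W).linearIndependent.map' W.subtype W.ker_subtype,
    fun k => (Module.finBasis F W k).2⟩

lemma vecMul_injective_of_det_ne_zero {ι R : Type*} [Fintype ι] [DecidableEq ι] [CommRing R]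
    [IsDomain R] {M : Matrix ι ι R} (hM : M.det ≠ 0) :
    Function.Injective fun v => Matrix.vecMul v M := fun u v h =>
  sub_eq_zero.mp (Matrix.eq_zero_of_vecMul_eq_zero hM
    (by rw [Matrix.sub_vecMul, sub_eq_zero]; exact h))

/-- The determinant of a matrix of 1-forms is divisible by the product of common divisors of the
contractions along a basis. -/
lemma prod_dvd_det {ι : Type*} [Fintype ι] (b : Module.Basis ι F (Fin n → F))
    (d : ι → MvPolynomial (Fin n) F) (M : Matrix (Fin n) (Fin n) (MvPolynomial (Fin n) F))
    (hd : ∀ k i, d k ∣ contract (b k) (M i)) : ∏ k, d k ∣ M.det := by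
  classical
  let e : ι ≃ Fin n := b.indexEquiv (Pi.basisFun F (Fin n))
  let B : Matrix (Fin n) (Fin n) F := (Pi.basisFun F (Fin n)).toMatrix (b.reindex e)
  have hB : IsUnit (B.map C : Matrix (Fin n) (Fin n) (MvPolynomial (Fin n) F)).det := by
    have h : IsUnit B.det := by
      rw [← Matrix.isUnit_iff_isUnit_det]
      let := (Pi.basisFun F (Fin n)).invertibleToMatrix (b.reindex e)
      exact isUnit_of_invertible B
    have h' := h.map (C : F →+* MvPolynomial (Fin n) F)
    rwa [RingHom.map_det] at h'
  have hMB : ∀ i k, (M * (B.map C : Matrix (Fin n) (Fin n) (MvPolynomial (Fin n) F))) i k =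
      contract (b (e.symm k)) (M i) := fun i k => by
    simp [Matrix.mul_apply, contract, B, Module.Basis.toMatrix_apply]
  choose q hq using hd
  have hfac : (M * B.map C).det =
      (∏ k, d (e.symm k)) * (Matrix.of fun i k => q (e.symm k) i).det := by
    rw [← Matrix.det_mul_row]
    congr 1
    ext1 i k
    rw [hMB, hq]
    rfl
  rw [← hB.dvd_mul_right, ← Matrix.det_mul, hfac, e.symm.prod_comp]
  exact dvd_mul_right _ _

lemma pow_dvd_det_of_linearIndependent {r p q : ℕ} {v : Fin n → F} {t : Fin r → Fin n → F}
    (hvt : LinearIndependent F (Fin.cons v t : Fin (r + 1) → Fin n → F))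
    (L : MvPolynomial (Fin n) F) (M : Matrix (Fin n) (Fin n) (MvPolynomial (Fin n) F))
    (hv : ∀ i, L ^ p ∣ contract v (M i)) (ht : ∀ k i, L ^ q ∣ contract (t k) (M i)) :
    L ^ (p + r * q) ∣ M.det := by
  obtain ⟨m, b, hbl⟩ := exists_basis_sum_of_linearIndependent hvt
  let d : Fin (r + 1) → ℕ := Fin.cons p fun _ => q
  have h := prod_dvd_det b (Sum.elim (fun k => L ^ d k) fun _ => 1) M ?_
  · simpa [Fintype.prod_sum_type, Fin.prod_univ_succ, d, pow_add, pow_mul, pow_right_comm] using h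
  · rintro (k | k) i
    · rw [hbl, Sum.elim_inl]
      refine Fin.cases ?_ (fun k => ?_) k
      · simpa [d] using hv i
      · simpa [d] using ht k i
    · exact one_dvd _

section Stabilizer

variable (G : Subgroup (GLn F n)) {H : Submodule F (Fin n → F)} {z : (Fin n → F) →ₗ[F] F}

/-- `G_H` contains an element whose determinant has order `e_H`. -/
lemma exists_orderOf_det_eq [Finite G] (H : Submodule F (Fin n → F)) :
    ∃ g ∈ pointStab G H, orderOf (LinearEquiv.det g) = eH G H ∧ 0 < eH G H := by
  let D : pointStab G H →* Fˣ := LinearEquiv.det.comp (pointStab G H).subtype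
  have : Finite (pointStab G H) :=
    Finite.of_injective (fun g => (⟨g.1, g.2.1⟩ : G)) fun _ _ hgh =>
      Subtype.ext (congrArg (fun x : G => x.1) hgh)
  have : Finite D.range := Finite.of_surjective D.rangeRestrict D.rangeRestrict_surjective
  have hker : (KH G H).subgroupOf (pointStab G H) = D.ker := by
    ext g
    simp [KH, Subgroup.mem_subgroupOf, D, MonoidHom.mem_ker]
  have he : eH G H = Nat.card D.range := by rw [eH, hker, Subgroup.index_ker]
  obtain ⟨x, hx⟩ := IsCyclic.exists_ofOrder_eq_natCard (α := D.range)
  obtain ⟨g, hg⟩ := x.2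
  refine ⟨g.1, g.2, ?_, he ▸ Nat.card_pos⟩
  rw [he, ← hx, ← Subgroup.orderOf_coe, ← hg]
  rfl

variable {G}

lemma fix_ker_of_mem_pointStab (hz : LinearMap.ker z = H) {g : GLn F n}
    (hg : g ∈ pointStab G H) : ∀ v ∈ LinearMap.ker z, g v = v := hz ▸ hg.2

lemma exists_symm_root (hz0 : z ≠ 0) (hz : LinearMap.ker z = H) {g : GLn F n}
    (hg : g ∈ pointStab G H) : ∃ a, ∀ v, g.symm v = v + z v • a :=
  exists_root_of_fix_ker hz0 (fix_ker_of_mem_pointStab hz ((pointStab G H).inv_mem hg))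

lemma trvSpace_le_ker (hz0 : z ≠ 0) (hz : LinearMap.ker z = H) :
    trvSpace G H ≤ LinearMap.ker z := by
  refine iSup₂_le fun g ⟨hg, ht⟩ => ?_
  obtain ⟨a, ha⟩ := exists_root_of_fix_ker hz0 (fix_ker_of_mem_pointStab hz hg)
  have hza : z a = 0 := by
    have := (det_of_root ha).symm.trans ht.2.1
    simpa using this
  rintro _ ⟨v, rfl⟩
  simp [ha, hza]

lemma dvd_contract_of_mem_trvSpace (hz0 : z ≠ 0) (hz : LinearMap.ker z = H)
    {w : Fin n → MvPolynomial (Fin n) F} (hw : ∀ g ∈ G, oneFormAct g w = w)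
    {v : Fin n → F} (hv : v ∈ trvSpace G H) : linToPoly z ∣ contract v w := by
  let W : Submodule F (Fin n → F) :=
    { carrier := {v | linToPoly z ∣ contract v w}
      add_mem' := fun {u v} hu hv => by
        rw [Set.mem_ofPred_eq, contract_add]
        exact dvd_add hu hv
      zero_mem' := by simp [contract]
      smul_mem' := fun r v hv => by
        rw [Set.mem_ofPred_eq, contract_smul]
        exact hv.mul_left _ }
  suffices h : trvSpace G H ≤ W from h hv
  refine iSup₂_le fun g ⟨hg, _⟩ => ?_
  rintro _ ⟨v, rfl⟩
  obtain ⟨a, ha⟩ := exists_symm_root hz0 hz hg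
  change linToPoly z ∣ contract (g v - v) w
  rw [contract_sub, contract_apply_of_invariant (hw g hg.1)]
  exact dvd_polyAct_sub ha _

/-- If `g ∈ G_H` scales `v` by `η`, the contraction of an invariant form along `v` is
semi-invariant, which bounds below its multiplicity along `H`. -/
lemma pow_dvd_contract (hz0 : z ≠ 0) (hz : LinearMap.ker z = H) {g : GLn F n}
    (hg : g ∈ pointStab G H) {w : Fin n → MvPolynomial (Fin n) F}
    (hw : ∀ g ∈ G, oneFormAct g w = w) {v : Fin n → F} {η : F} (hv : g v = η • v) {m : ℕ}
    (hm : ∀ k, (((LinearEquiv.det g)⁻¹ : Fˣ) : F) ^ k = η →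
      (linToPoly z ∣ contract v w → k ≠ 0) → m ≤ k) :
    linToPoly z ^ m ∣ contract v w := by
  obtain ⟨a, ha⟩ := exists_symm_root hz0 hz hg
  refine pow_dvd_of_semiinvariant (irreducible_linToPoly hz0).prime (dvd_polyAct_sub ha) ?_
    (by rw [← contract_apply_of_invariant (hw g hg.1), hv, contract_smul]; rfl) hm
  rw [polyAct_linToPoly_of_root ha, ← det_of_root (g := g.symm) ha, ← map_inv,
    LinearEquiv.coe_det]
  rfl

variable (G) in
/-- A vector outside `H` along which all invariant forms vanish to order `e_H - 1` on `H`. -/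
lemma exists_pow_dvd_contract [Finite G] (hz0 : z ≠ 0) (hz : LinearMap.ker z = H) :
    ∃ v, z v ≠ 0 ∧ ∀ w : Fin n → MvPolynomial (Fin n) F, (∀ g ∈ G, oneFormAct g w = w) →
      linToPoly z ^ (eH G H - 1) ∣ contract v w := by
  obtain ⟨g, hg, ho, -⟩ := exists_orderOf_det_eq G H
  obtain ⟨a, ha⟩ := exists_root_of_fix_ker hz0 (fix_ker_of_mem_pointStab hz hg)
  have hdet : ((LinearEquiv.det g : Fˣ) : F) = 1 + z a := by
    rw [LinearEquiv.coe_det, ← det_of_root ha]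
  by_cases hza : z a = 0
  · have h1 : LinearEquiv.det g = 1 := Units.ext (by simp [hdet, hza])
    obtain ⟨u, hu⟩ := LinearMap.surjective hz0 1
    refine ⟨u, by simp [hu], fun w _ => ?_⟩
    rw [h1, orderOf_one] at ho
    simp [← ho]
  · refine ⟨a, hza, fun w hw => ?_⟩
    refine pow_dvd_contract hz0 hz hg hw (η := ((LinearEquiv.det g : Fˣ) : F))
      (by rw [ha, hdet, add_smul, one_smul]) fun k hk _ => ?_
    have hk' : LinearEquiv.det g ^ (k + 1) = 1 := by
      rw [← Units.val_pow_eq_pow_val, Units.val_inj, inv_pow] at hk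
      rw [pow_succ, mul_eq_one_iff_inv_eq, hk]
    have := Nat.le_of_dvd k.succ_pos (ho ▸ orderOf_dvd_of_pow_eq_one hk')
    omega

lemma pow_eH_dvd_contract [Finite G] (hz0 : z ≠ 0) (hz : LinearMap.ker z = H)
    {w : Fin n → MvPolynomial (Fin n) F} (hw : ∀ g ∈ G, oneFormAct g w = w)
    {v : Fin n → F} (hv : v ∈ trvSpace G H) : linToPoly z ^ eH G H ∣ contract v w := by
  obtain ⟨g, hg, ho, -⟩ := exists_orderOf_det_eq G H
  have hgv : g v = v := fix_ker_of_mem_pointStab hz hg v (trvSpace_le_ker hz0 hz hv)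
  refine pow_dvd_contract hz0 hz hg hw (η := 1) (by rw [hgv, one_smul]) fun k hk hk0 => ?_
  have hk' : LinearEquiv.det g ^ k = 1 := by
    rw [← Units.val_pow_eq_pow_val, Units.val_eq_one, inv_pow, inv_eq_one] at hk
    exact hk
  exact Nat.le_of_dvd
    (Nat.pos_of_ne_zero (hk0 (dvd_contract_of_mem_trvSpace hz0 hz hw hv)))
    (ho ▸ orderOf_dvd_of_pow_eq_one hk')

/-- The local divisibility at `H` of the wedge of `n` invariant 1-forms. -/
lemma linToPoly_pow_dvd_det [Finite G] (hz0 : z ≠ 0) (hz : LinearMap.ker z = H)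
    (M : Matrix (Fin n) (Fin n) (MvPolynomial (Fin n) F))
    (hM : ∀ i, ∀ g ∈ G, oneFormAct g (M i) = M i) :
    linToPoly z ^ (eH G H * bH G H + eH G H - 1) ∣ M.det := by
  obtain ⟨v, hv, hvd⟩ := exists_pow_dvd_contract G hz0 hz
  obtain ⟨t, ht, htmem⟩ := (trvSpace G H).exists_linearIndependent_fin_finrank
  have hvt : LinearIndependent F (Fin.cons v t : Fin (Module.finrank F (trvSpace G H) + 1) → Fin n → F) :=
    linearIndependent_finCons.mpr ⟨ht, fun hmem => hv (trvSpace_le_ker hz0 hz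
      (Submodule.span_le.mpr (Set.range_subset_iff.mpr htmem) hmem))⟩
  obtain ⟨-, -, -, he⟩ := exists_orderOf_det_eq G H
  have hexp : eH G H * bH G H + eH G H - 1 = (eH G H - 1) + bH G H * eH G H := by
    rw [mul_comm, Nat.add_sub_assoc he, add_comm]
  rw [hexp]
  exact pow_dvd_det_of_linearIndependent hvt _ M (fun i => hvd _ (hM i))
    fun k i => pow_eH_dvd_contract hz0 hz (hM i) (htmem k)

end Stabilizer

lemma polyAct_eq_self_of_vecMul_eq {g : GLn F n}
    {M : Matrix (Fin n) (Fin n) (MvPolynomial (Fin n) F)} (hdet : M.det ≠ 0)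
    (hM : ∀ i, oneFormAct g (M i) = M i) {h μ : Fin n → MvPolynomial (Fin n) F}
    (hμ : oneFormAct g μ = μ) (hh : Matrix.vecMul h M = μ) (i : Fin n) :
    polyAct g (h i) = h i := by
  have key : Matrix.vecMul (fun i => polyAct g (h i)) M = μ := by
    rw [← hμ, ← hh]
    ext1 j
    simp only [Matrix.vecMul, dotProduct, oneFormAct, map_sum, map_mul, Finset.sum_mul]
    rw [Finset.sum_comm]
    refine Finset.sum_congr rfl fun i _ => ?_
    conv_lhs => rw [← hM i]
    simp only [oneFormAct, Finset.mul_sum, mul_assoc]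
  exact congrFun (vecMul_injective_of_det_ne_zero hdet (key.trans hh.symm)) i

/-- Saito-type freeness criterion. If invariant 1-forms `ω₁,…,ωₙ`
satisfy `ω₁ ∧ ⋯ ∧ ωₙ ≐ Q(Ã)·Q_det·vol`, then they form a basis of `(Ω¹)^G` as a free
`F[V]^G`-module: every invariant 1-form is uniquely an `F[V]^G`-combination of them. -/
theorem stmt8 {F : Type*} [Field F] (h2 : ringChar F ≠ 2) {n : ℕ}
    (G : Subgroup (GLn F n)) [Finite G]
    (hrefl : Subgroup.closure {g : GLn F n | g ∈ G ∧ IsReflection g} = G)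
    (A : Finset (Submodule F (Fin n → F)))
    (hA : ∀ H, H ∈ A ↔ ∃ g ∈ G, IsReflection g ∧ fixedSpace g = H)
    (ℓ : Submodule F (Fin n → F) → ((Fin n → F) →ₗ[F] F))
    (hℓ : ∀ H ∈ A, ℓ H ≠ 0 ∧ LinearMap.ker (ℓ H) = H)
    (ω : Fin n → Fin n → MvPolynomial (Fin n) F)
    (hω : ∀ i, ∀ g ∈ G, oneFormAct g (ω i) = ω i)
    (c : F) (hc : c ≠ 0)
    (hdet : Matrix.det (Matrix.of fun i j => ω i j) =
      C c * ∏ H ∈ A, linToPoly (ℓ H) ^ (eH G H * bH G H + eH G H - 1)) :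
    ∀ μ : Fin n → MvPolynomial (Fin n) F, (∀ g ∈ G, oneFormAct g μ = μ) →
      ∃! h : Fin n → MvPolynomial (Fin n) F,
        (∀ i, h i ∈ invSub G) ∧ ∀ j, μ j = ∑ i, h i * ω i j := by
  intro μ hμ
  set M : Matrix (Fin n) (Fin n) (MvPolynomial (Fin n) F) := Matrix.of fun i j => ω i j
  set Q := ∏ H ∈ A, linToPoly (ℓ H) ^ (eH G H * bH G H + eH G H - 1)
  have hM : ∀ i, ∀ g ∈ G, oneFormAct g (M i) = M i := hω
  have hQ0 : Q ≠ 0 := Finset.prod_ne_zero_iff.mpr fun H hH =>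
    pow_ne_zero _ (irreducible_linToPoly (hℓ H hH).1).ne_zero
  have hM0 : M.det ≠ 0 := by
    rw [hdet]
    exact mul_ne_zero (by simpa using hc) hQ0
  have hdvd : ∀ i, M.det ∣ (M.updateRow i μ).det := fun i => by
    rw [hdet, ((isUnit_iff_ne_zero.mpr hc).map C).mul_left_dvd]
    refine Finset.prod_dvd_of_isRelPrime (fun H hH H' hH' hne => ?_) fun H hH => ?_
    · refine (isRelPrime_linToPoly (hℓ H hH).1 (hℓ H' hH').1 ?_).pow
      rwa [(hℓ H hH).2, (hℓ H' hH').2]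
    · refine linToPoly_pow_dvd_det (hℓ H hH).1 (hℓ H hH).2 _ fun k g hg => ?_
      rcases eq_or_ne k i with rfl | hk
      · rw [Matrix.updateRow_self]
        exact hμ g hg
      · rw [Matrix.updateRow_ne hk]
        exact hM k g hg
  choose h hh using hdvd
  have hsol : Matrix.vecMul h M = μ := by
    have h1 := Matrix.mulVec_cramer M.transpose μ
    have h2 : M.transpose.cramer μ = M.det • h := by
      ext1 i
      rw [Matrix.cramer_transpose_apply, hh, Pi.smul_apply, smul_eq_mul]
    rw [h2, Matrix.mulVec_smul, Matrix.det_transpose, Matrix.mulVec_transpose] at h1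
    exact smul_right_injective _ hM0 h1
  refine ⟨h, ⟨fun i g hg => polyAct_eq_self_of_vecMul_eq hM0 (fun i => hM i g hg) (hμ g hg) hsol i,
    fun j => (congrFun hsol j).symm⟩, fun h' hh' => ?_⟩
  refine vecMul_injective_of_det_ne_zero hM0 ((funext fun j => (hh'.2 j).symm).trans hsol.symm)
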